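/- In the positive part U^+ of U_q(sl̂_2), specializing Damiani's construction: the element E_δ = −E_0E_1 + q^{-2}E_1E_0 satisfies [E_δ, E_{nδ+α_0}] = [2]_q E_{(n+1)δ+α_0} for all n ≥ 0, where E_{nδ+α_0} are the real root vectors obtained by Lusztig's braid group action. -/

import Mathlib

set_option synthInstance.maxHeartbeats 1000000
set_option maxHeartbeats 1000000

noncomputable section

open scoped BigOperators

/-- The field `ℚ(q)`. -/
abbrev KK : Type := RatFunc ℚ

/-- The indeterminate `q`. -/
def qq : KK := RatFunc.X

/-- Generators of `U_q(sl̂₂)`: `(i, 0) = Eᵢ`, `(i, 1) = Fᵢ`, `(i, 2) = Kᵢ`, `(i, 3) = Kᵢ⁻¹`. -/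
abbrev UqGen : Type := Fin 2 × Fin 4

def ge (i : Fin 2) : FreeAlgebra KK UqGen := FreeAlgebra.ι KK (i, 0)
def gf (i : Fin 2) : FreeAlgebra KK UqGen := FreeAlgebra.ι KK (i, 1)
def gk (i : Fin 2) : FreeAlgebra KK UqGen := FreeAlgebra.ι KK (i, 2)
def gki (i : Fin 2) : FreeAlgebra KK UqGen := FreeAlgebra.ι KK (i, 3)

/-- The defining relations of the quantized enveloping algebra `U_q(sl̂₂)` of affine `sl₂`
(Cartan matrix `a_{ii} = 2`, `a_{ij} = −2` for `i ≠ j`). -/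
inductive uqRel : FreeAlgebra KK UqGen → FreeAlgebra KK UqGen → Prop
  | kinv (i : Fin 2) : uqRel (gk i * gki i) 1
  | invk (i : Fin 2) : uqRel (gki i * gk i) 1
  | kk (i j : Fin 2) : uqRel (gk i * gk j) (gk j * gk i)
  | ke_same (i : Fin 2) : uqRel (gk i * ge i) (qq ^ 2 • (ge i * gk i))
  | ke_diff (i j : Fin 2) : i ≠ j → uqRel (gk i * ge j) (((qq⁻¹) ^ 2) • (ge j * gk i))
  | kf_same (i : Fin 2) : uqRel (gk i * gf i) (((qq⁻¹) ^ 2) • (gf i * gk i))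
  | kf_diff (i j : Fin 2) : i ≠ j → uqRel (gk i * gf j) (qq ^ 2 • (gf j * gk i))
  | ef_same (i : Fin 2) :
      uqRel (ge i * gf i - gf i * ge i) ((qq - qq⁻¹)⁻¹ • (gk i - gki i))
  | ef_diff (i j : Fin 2) : i ≠ j → uqRel (ge i * gf j) (gf j * ge i)
  | serre_e (i j : Fin 2) : i ≠ j → uqRel
      (ge i ^ 3 * ge j - (qq ^ 2 + 1 + (qq⁻¹) ^ 2) • (ge i ^ 2 * ge j * ge i)
        + (qq ^ 2 + 1 + (qq⁻¹) ^ 2) • (ge i * ge j * ge i ^ 2) - ge j * ge i ^ 3) 0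
  | serre_f (i j : Fin 2) : i ≠ j → uqRel
      (gf i ^ 3 * gf j - (qq ^ 2 + 1 + (qq⁻¹) ^ 2) • (gf i ^ 2 * gf j * gf i)
        + (qq ^ 2 + 1 + (qq⁻¹) ^ 2) • (gf i * gf j * gf i ^ 2) - gf j * gf i ^ 3) 0

/-- The quantized enveloping algebra `U_q(sl̂₂)`. -/
abbrev Uq : Type := RingQuot uqRel

def Ee (i : Fin 2) : Uq := RingQuot.mkAlgHom KK uqRel (ge i)
def Ff (i : Fin 2) : Uq := RingQuot.mkAlgHom KK uqRel (gf i)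
def Kk (i : Fin 2) : Uq := RingQuot.mkAlgHom KK uqRel (gk i)
def Kki (i : Fin 2) : Uq := RingQuot.mkAlgHom KK uqRel (gki i)

/-- `E_δ = −E₀E₁ + q⁻²E₁E₀`. -/
def Edel : Uq := -(Ee 0 * Ee 1) + ((qq⁻¹) ^ 2) • (Ee 1 * Ee 0)

/-- The alternating word `T_{0,L}T_{1,L}T_{0,L}⋯` of `n` braid-automorphism factors. -/
def wordFun (TL : Fin 2 → (Uq ≃ₐ[KK] Uq)) : ℕ → (Uq → Uq)
  | 0 => id
  | n + 1 => wordFun TL n ∘ ⇑(TL ⟨n % 2, Nat.mod_lt n (by norm_num)⟩)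

/-- Damiani's real root vectors `E_{nδ+α₀} = T_{0,L}T_{1,L}⋯T_{i,L}(E_j)` (`n` factors,
`j ≠ i`); equivalently `wordFun TL n` applied to `E_{n % 2}`. -/
def Ea0 (TL : Fin 2 → (Uq ≃ₐ[KK] Uq)) (n : ℕ) : Uq :=
  wordFun TL n (Ee ⟨n % 2, Nat.mod_lt n (by norm_num)⟩)

theorem aux_nc {k A : Type*} [Field k] [Ring A] [Algebra k A] (q : k) (hq : q ≠ 0)
    (h2 : q + q⁻¹ ≠ 0) (h3 : q - q⁻¹ ≠ 0) (E X F K L : A)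
    (hKL : K * L = 1) (hLK : L * K = 1)
    (hKE : K * E = q ^ 2 • (E * K)) (hKX : K * X = ((q⁻¹) ^ 2) • (X * K))
    (hEF : E * F - F * E = (q - q⁻¹)⁻¹ • (K - L)) (hXF : X * F = F * X) :
    -(((q + q⁻¹)⁻¹ • (E ^ 2 * X - (q⁻¹ * (q + q⁻¹)) • (E * X * E)
        + ((q⁻¹) ^ 2) • (X * E ^ 2))) * -(F * K)) +
      ((q⁻¹) ^ 2) • (-(F * K) * ((q + q⁻¹)⁻¹ • (E ^ 2 * X - (q⁻¹ * (q + q⁻¹)) • (E * X * E)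
        + ((q⁻¹) ^ 2) • (X * E ^ 2)))) = -(E * X) + ((q⁻¹) ^ 2) • (X * E) := by
  have hLE : L * E = (q⁻¹) ^ 2 • (E * L) := by
    have : L * (K * E) * L = q ^ 2 • (L * (E * (K * L))) := by
      rw [hKE]; simp only [mul_smul_comm, smul_mul_assoc, mul_assoc]
    rw [← mul_assoc, hLK, one_mul, hKL, mul_one] at this
    rw [this, smul_smul, ← mul_pow, inv_mul_cancel₀ hq, one_pow, one_smul]
  have hLX : L * X = q ^ 2 • (X * L) := by
    have : L * (K * X) * L = (q⁻¹) ^ 2 • (L * (X * (K * L))) := by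
      rw [hKX]; simp only [mul_smul_comm, smul_mul_assoc, mul_assoc]
    rw [← mul_assoc, hLK, one_mul, hKL, mul_one] at this
    rw [this, smul_smul, ← mul_pow, mul_inv_cancel₀ hq, one_pow, one_smul]
  have hEF' : E * F = F * E + (q - q⁻¹)⁻¹ • (K - L) := by rw [← hEF]; abel
  have aEF : ∀ z, E * (F * z) = F * (E * z) + (q - q⁻¹)⁻¹ • (K * z - L * z) := fun z => by
    rw [← mul_assoc, hEF']; simp only [add_mul, smul_mul_assoc, sub_mul, mul_assoc]
  have aXF : ∀ z, X * (F * z) = F * (X * z) := fun z => by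
    rw [← mul_assoc, hXF, mul_assoc]
  have aKE : ∀ z, K * (E * z) = q ^ 2 • (E * (K * z)) := fun z => by
    rw [← mul_assoc, hKE, smul_mul_assoc, mul_assoc]
  have aKX : ∀ z, K * (X * z) = (q⁻¹) ^ 2 • (X * (K * z)) := fun z => by
    rw [← mul_assoc, hKX, smul_mul_assoc, mul_assoc]
  have aLE : ∀ z, L * (E * z) = (q⁻¹) ^ 2 • (E * (L * z)) := fun z => by
    rw [← mul_assoc, hLE, smul_mul_assoc, mul_assoc]
  have aLX : ∀ z, L * (X * z) = q ^ 2 • (X * (L * z)) := fun z => by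
    rw [← mul_assoc, hLX, smul_mul_assoc, mul_assoc]
  have h4 : q ^ 2 + 1 ≠ 0 := fun h => h2 (by field_simp; rw [h, mul_zero])
  have h5 : q ^ 2 - 1 ≠ 0 := fun h => h3 (by field_simp; rw [h, mul_zero])
  simp only [pow_two E, mul_add, add_mul, mul_sub, sub_mul, neg_mul, mul_neg, neg_neg,
    mul_smul_comm, smul_mul_assoc, mul_assoc, aEF, aXF, aKE, aKX, aLE, aLX, hKE, hKX, hLE, hLX,
    hLK, mul_one]
  match_scalars <;> field_simp <;> ring

theorem aux_comm {k A : Type*} [Field k] [Ring A] [Algebra k A] (q : k) (hq : q ≠ 0) (E X : A) :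
    (-(E * X) + ((q⁻¹) ^ 2) • (X * E)) * E - E * (-(E * X) + ((q⁻¹) ^ 2) • (X * E)) =
      E ^ 2 * X - (q⁻¹ * (q + q⁻¹)) • (E * X * E) + ((q⁻¹) ^ 2) • (X * E ^ 2) := by
  simp only [pow_two E, mul_add, add_mul, neg_mul, mul_neg,
    mul_smul_comm, smul_mul_assoc, mul_assoc]
  match_scalars <;> field_simp <;> ring

theorem qq_ne : qq ≠ 0 := RatFunc.X_ne_zero

theorem qq_pow_ne (c : ℚ) : qq ^ 2 + RatFunc.C c ≠ 0 := by
  intro h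
  have h1 : algebraMap (Polynomial ℚ) KK (Polynomial.X ^ 2 + Polynomial.C c) = 0 := by
    rw [map_add, map_pow, RatFunc.algebraMap_X, RatFunc.algebraMap_C]; exact h
  have h2 := (map_eq_zero_iff _ (RatFunc.algebraMap_injective ℚ)).1 h1
  exact Polynomial.X_pow_add_C_ne_zero (by norm_num) c h2

theorem qq_add_ne : qq + qq⁻¹ ≠ 0 := by
  intro h
  apply qq_pow_ne 1
  have : qq * (qq + qq⁻¹) = 0 := by rw [h, mul_zero]
  rw [mul_add, mul_inv_cancel₀ qq_ne] at this
  rw [map_one, pow_two]; exact this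

theorem qq_sub_ne : qq - qq⁻¹ ≠ 0 := by
  intro h
  apply qq_pow_ne (-1)
  have : qq * (qq - qq⁻¹) = 0 := by rw [h, mul_zero]
  rw [mul_sub, mul_inv_cancel₀ qq_ne] at this
  rw [map_neg, map_one, pow_two, ← sub_eq_add_neg]; exact this

/-- The two versions of `E_δ`, with the roles of the indices interchanged. -/
def EdelAt (i j : Fin 2) : Uq := -(Ee i * Ee j) + ((qq⁻¹) ^ 2) • (Ee j * Ee i)

theorem T_EdelAt (TL : Fin 2 → (Uq ≃ₐ[KK] Uq))
    (hE_same : ∀ i, TL i (Ee i) = -(Ff i * Kk i))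
    (hE_diff : ∀ i j, i ≠ j → TL i (Ee j) =
      (qq + qq⁻¹)⁻¹ • (Ee i ^ 2 * Ee j - (qq⁻¹ * (qq + qq⁻¹)) • (Ee i * Ee j * Ee i)
        + ((qq⁻¹) ^ 2) • (Ee j * Ee i ^ 2))) (i j : Fin 2) (hij : i ≠ j) :
    TL i (EdelAt j i) = EdelAt i j := by
  unfold EdelAt
  rw [map_add, map_neg, map_smul, map_mul, map_mul, hE_same i, hE_diff i j hij]
  apply aux_nc qq qq_ne qq_add_ne qq_sub_ne (Ee i) (Ee j) (Ff i) (Kk i) (Kki i)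
  · simpa [Kk, Kki] using RingQuot.mkAlgHom_rel KK (uqRel.kinv i)
  · simpa [Kk, Kki] using RingQuot.mkAlgHom_rel KK (uqRel.invk i)
  · simpa only [Kk, Ee, map_mul, map_smul] using RingQuot.mkAlgHom_rel KK (uqRel.ke_same i)
  · simpa only [Kk, Ee, map_mul, map_smul] using RingQuot.mkAlgHom_rel KK (uqRel.ke_diff i j hij)
  · simpa only [Kk, Kki, Ee, Ff, map_mul, map_smul, map_sub] using
      RingQuot.mkAlgHom_rel KK (uqRel.ef_same i)
  · simpa only [Ee, Ff, map_mul] using RingQuot.mkAlgHom_rel KK (uqRel.ef_diff j i hij.symm)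

theorem comm_EdelAt (TL : Fin 2 → (Uq ≃ₐ[KK] Uq))
    (hE_diff : ∀ i j, i ≠ j → TL i (Ee j) =
      (qq + qq⁻¹)⁻¹ • (Ee i ^ 2 * Ee j - (qq⁻¹ * (qq + qq⁻¹)) • (Ee i * Ee j * Ee i)
        + ((qq⁻¹) ^ 2) • (Ee j * Ee i ^ 2))) (i j : Fin 2) (hij : i ≠ j) :
    EdelAt i j * Ee i - Ee i * EdelAt i j = (qq + qq⁻¹) • TL i (Ee j) := by
  rw [hE_diff i j hij, smul_smul, mul_inv_cancel₀ qq_add_ne, one_smul, EdelAt]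
  exact aux_comm qq qq_ne (Ee i) (Ee j)

/-- The residue of `n` modulo two, as an index. -/
abbrev par (n : ℕ) : Fin 2 := ⟨n % 2, Nat.mod_lt n (by norm_num)⟩

theorem par_ne (n : ℕ) : par n ≠ par (n + 1) := by
  intro h
  have := congrArg Fin.val h
  simp only [par] at this
  omega

theorem par_add_two (n : ℕ) : par (n + 1 + 1) = par n := by
  apply Fin.ext
  simp only [par]
  omega

/-- `wordFun` as an algebra homomorphism. -/
def wordHom (TL : Fin 2 → (Uq ≃ₐ[KK] Uq)) : ℕ → (Uq →ₐ[KK] Uq)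
  | 0 => AlgHom.id KK Uq
  | n + 1 => (wordHom TL n).comp (TL (par n)).toAlgHom

theorem wordHom_succ (TL : Fin 2 → (Uq ≃ₐ[KK] Uq)) (n : ℕ) (x : Uq) :
    wordHom TL (n + 1) x = wordHom TL n (TL (par n) x) := rfl

theorem wordFun_eq (TL : Fin 2 → (Uq ≃ₐ[KK] Uq)) (n : ℕ) (x : Uq) :
    wordFun TL n x = wordHom TL n x := by
  induction n generalizing x with
  | zero => rfl
  | succ n ih => exact ih _

/-- In `U⁺ ⊆ U_q(sl̂₂)`, with `E_δ = −E₀E₁ + q⁻²E₁E₀` and the real root vectors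
`E_{nδ+α₀}` produced by Lusztig's braid group action, one has
`[E_δ, E_{nδ+α₀}] = [2]_q E_{(n+1)δ+α₀}` for all `n ≥ 0`. -/
theorem stmt13 (TL : Fin 2 → (Uq ≃ₐ[KK] Uq))
    (hE_same : ∀ i, TL i (Ee i) = -(Ff i * Kk i))
    (hF_same : ∀ i, TL i (Ff i) = -(Kki i * Ee i))
    (hK_same : ∀ i, TL i (Kk i) = Kki i)
    (hK_diff : ∀ i j, i ≠ j → TL i (Kk j) = Kk j * Kk i ^ 2)
    (hE_diff : ∀ i j, i ≠ j → TL i (Ee j) =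
      (qq + qq⁻¹)⁻¹ • (Ee i ^ 2 * Ee j - (qq⁻¹ * (qq + qq⁻¹)) • (Ee i * Ee j * Ee i)
        + ((qq⁻¹) ^ 2) • (Ee j * Ee i ^ 2)))
    (hF_diff : ∀ i j, i ≠ j → TL i (Ff j) =
      (qq + qq⁻¹)⁻¹ • (Ff j * Ff i ^ 2 - (qq * (qq + qq⁻¹)) • (Ff i * Ff j * Ff i)
        + (qq ^ 2) • (Ff i ^ 2 * Ff j))) :
    ∀ n : ℕ, Edel * Ea0 TL n - Ea0 TL n * Edel = (qq + qq⁻¹) • Ea0 TL (n + 1) := by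
  intro n
  have hw : ∀ n, wordHom TL n (EdelAt (par n) (par (n + 1))) = Edel := by
    intro n
    induction n with
    | zero => rfl
    | succ n ih =>
      rw [wordHom_succ, par_add_two, T_EdelAt TL hE_same hE_diff _ _ (par_ne n), ih]
  have e0 : ∀ n, Ea0 TL n = wordHom TL n (Ee (par n)) := fun n => wordFun_eq TL n _
  rw [e0, e0, wordHom_succ, ← hw n, ← map_mul, ← map_mul, ← map_sub,
    comm_EdelAt TL hE_diff _ _ (par_ne n), map_smul]

end
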